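/- Assume n > m and let k ∈ ℕ with k > n/m. Then for all 1 ≤ p ≤ q ≤ ∞ there is a constant C such that for every t > 0 and every Schwartz function f, ‖𝓕⁻¹((1 + tP(·))^{−k} f̂)‖_{L^q} ≤ C t^{−(n/m)(1/p − 1/q)} ‖f‖_{L^p}. -/

import Mathlib

open MeasureTheory Complex
open scoped ENNReal RealInnerProductSpace

noncomputable section

/-- The Fourier transform `f̂(ξ) = ∫ e^{−ix·ξ} f(x) dx`. -/
def FT {n : ℕ} (f : EuclideanSpace ℝ (Fin n) → ℂ) (ξ : EuclideanSpace ℝ (Fin n)) : ℂ :=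
  ∫ x, Complex.exp (-Complex.I * (⟪x, ξ⟫ : ℂ)) * f x

/-- The inverse Fourier transform `𝓕⁻¹g(x) = (2π)^{−n} ∫ e^{ix·ξ} g(ξ) dξ`. -/
def IFT {n : ℕ} (g : EuclideanSpace ℝ (Fin n) → ℂ) (x : EuclideanSpace ℝ (Fin n)) : ℂ :=
  (((2 * Real.pi) ^ n : ℝ) : ℂ)⁻¹ * ∫ ξ, Complex.exp (Complex.I * (⟪x, ξ⟫ : ℂ)) * g ξ

/-- The determinant of the Hessian matrix `(∂²f/∂ξᵢ∂ξⱼ)` of `f` at `ξ`. -/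
def HessDet {n : ℕ} (f : EuclideanSpace ℝ (Fin n) → ℝ) (ξ : EuclideanSpace ℝ (Fin n)) : ℝ :=
  Matrix.det (Matrix.of fun i j : Fin n =>
    fderiv ℝ (fun y => fderiv ℝ f y (EuclideanSpace.single j 1)) ξ (EuclideanSpace.single i 1))

lemma totalDegree_pderiv_le' {n : ℕ} (i : Fin n) (Q : MvPolynomial (Fin n) ℝ) :
    (MvPolynomial.pderiv i Q).totalDegree ≤ Q.totalDegree := by
  refine Finset.sup_le fun s hs => ?_
  have h1 : s + Finsupp.single i 1 ∈ Q.support := by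
    rw [MvPolynomial.mem_support_iff, MvPolynomial.coeff_pderiv] at hs
    rw [MvPolynomial.mem_support_iff]
    exact left_ne_zero_of_mul hs
  have h2 := MvPolynomial.le_totalDegree h1
  rw [Finsupp.sum_add_index' (by simp) (by simp)] at h2
  omega

lemma hasFDerivAt_evalPoly {n : ℕ} (Q : MvPolynomial (Fin n) ℝ) (ξ : EuclideanSpace ℝ (Fin n)) :
    HasFDerivAt (fun η : EuclideanSpace ℝ (Fin n) => MvPolynomial.eval (fun i => η i) Q)
      (∑ i, (MvPolynomial.eval (fun i => ξ i) (MvPolynomial.pderiv i Q)) •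
        (EuclideanSpace.proj i : EuclideanSpace ℝ (Fin n) →L[ℝ] ℝ)) ξ := by
  classical
  induction Q using MvPolynomial.induction_on with
  | C a => 
    simp only [MvPolynomial.eval_C, MvPolynomial.pderiv_C, map_zero, zero_smul, Finset.sum_const_zero]
    exact hasFDerivAt_const _ _
  | add p q hp hq =>
    have := hp.add hq
    simp only [map_add, add_smul, Finset.sum_add_distrib]
    exact this
  | mul_X p j hp =>
    have h2 : HasFDerivAt (fun η : EuclideanSpace ℝ (Fin n) => η j)
      (EuclideanSpace.proj j : EuclideanSpace ℝ (Fin n) →L[ℝ] ℝ) ξ :=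
        (EuclideanSpace.proj j : EuclideanSpace ℝ (Fin n) →L[ℝ] ℝ).hasFDerivAt
    have := hp.mul h2
    simp only [map_mul, MvPolynomial.eval_X]
    convert! this using 1
    ext v
    simp only [MvPolynomial.pderiv_mul, MvPolynomial.pderiv_X, Pi.single_apply]
    simp only [sum_apply, add_apply, smul_apply, smul_eq_mul,
      map_add, map_mul, add_mul, Finset.sum_add_distrib, Finset.mul_sum, MvPolynomial.eval_X]
    rw [add_comm]
    congr 1
    · rw [Finset.sum_eq_single j]
      · simp
      · intro b _ hb
        simp [hb.symm]
      · simp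
    · exact Finset.sum_congr rfl fun i _ => by ring

lemma evalPoly_bound {n : ℕ} (Q : MvPolynomial (Fin n) ℝ) :
    ∃ C : ℝ, 0 ≤ C ∧ ∀ ξ : EuclideanSpace ℝ (Fin n),
      |MvPolynomial.eval (fun i => ξ i) Q| ≤ C * (1 + ‖ξ‖) ^ Q.totalDegree := by
  refine ⟨∑ d ∈ Q.support, |Q.coeff d|, Finset.sum_nonneg fun _ _ => abs_nonneg _, fun ξ => ?_⟩
  rw [MvPolynomial.eval_eq', Finset.sum_mul]
  refine (Finset.abs_sum_le_sum_abs _ _).trans (Finset.sum_le_sum fun d hd => ?_)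
  rw [abs_mul, Finset.abs_prod]
  gcongr
  have h1 : (1:ℝ) ≤ 1 + ‖ξ‖ := by linarith [norm_nonneg ξ]
  calc ∏ i, |ξ i ^ d i| ≤ ∏ i, (1 + ‖ξ‖) ^ d i := by
        refine Finset.prod_le_prod (fun _ _ => abs_nonneg _) fun i _ => ?_
        rw [abs_pow]
        gcongr
        have := PiLp.norm_apply_le ξ i
        rw [Real.norm_eq_abs] at this
        linarith
    _ = (1 + ‖ξ‖) ^ (∑ i, d i) := by rw [Finset.prod_pow_eq_pow_sum]
    _ ≤ _ := by
        apply pow_le_pow_right₀ h1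
        have := MvPolynomial.le_totalDegree hd
        rwa [Finsupp.sum_fintype _ _ (by simp)] at this

lemma evalPoly_homog {n m : ℕ} (P : MvPolynomial (Fin n) ℝ) (hP : P.IsHomogeneous m) (r : ℝ)
    (ξ : EuclideanSpace ℝ (Fin n)) : MvPolynomial.eval (fun i => (r • ξ) i) P =
      r ^ m * MvPolynomial.eval (fun i => ξ i) P := by
  rw [MvPolynomial.eval_eq', MvPolynomial.eval_eq', Finset.mul_sum]
  refine Finset.sum_congr rfl fun d hd => ?_
  have := hP (MvPolynomial.mem_support_iff.1 hd)
  simp only [PiLp.smul_apply, smul_eq_mul, mul_pow, Finset.prod_mul_distrib, Finset.prod_pow_eq_pow_sum]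
  have h : ∑ i, d i = m := by
    rw [← this, Finsupp.weight_apply, Finsupp.sum_fintype _ _ (by simp)]; simp
  rw [h]; ring

lemma evalPoly_lower {n m : ℕ} (hn : 2 ≤ n) (P : MvPolynomial (Fin n) ℝ) (hP : P.IsHomogeneous m)
    (hell : ∀ ξ : EuclideanSpace ℝ (Fin n), ξ ≠ 0 → 0 < MvPolynomial.eval (fun i => ξ i) P) :
    ∃ c : ℝ, 0 < c ∧ ∀ ξ : EuclideanSpace ℝ (Fin n),
      c * (1 + ‖ξ‖) ^ m ≤ 1 + MvPolynomial.eval (fun i => ξ i) P := by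
  have : Nonempty (Fin n) := ⟨⟨0, by omega⟩⟩
  have hc : Continuous (fun η : EuclideanSpace ℝ (Fin n) => MvPolynomial.eval (fun i => η i) P) :=
    continuous_iff_continuousAt.2 fun ξ => (hasFDerivAt_evalPoly P ξ).continuousAt
  obtain ⟨η, hη, hmin⟩ := (isCompact_sphere (0 : EuclideanSpace ℝ (Fin n)) 1).exists_isMinOn
    (NormedSpace.sphere_nonempty.2 zero_le_one) hc.continuousOn
  have hη0 : η ≠ 0 := by
    rintro rfl; simp at hη
  set a := MvPolynomial.eval (fun i => η i) P with ha
  have ha0 : 0 < a := hell η hη0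
  have key : ∀ ξ : EuclideanSpace ℝ (Fin n), ξ ≠ 0 → a * ‖ξ‖ ^ m ≤ MvPolynomial.eval (fun i => ξ i) P := by
    intro ξ hξ
    have h1 : ‖ξ‖⁻¹ • ξ ∈ Metric.sphere (0 : EuclideanSpace ℝ (Fin n)) 1 := by
      simp [norm_smul, norm_ne_zero_iff.2 hξ]
    have h2 := hmin h1
    have h2 : a ≤ MvPolynomial.eval (fun i => (‖ξ‖⁻¹ • ξ) i) P := h2
    rw [evalPoly_homog P hP] at h2
    have : 0 < ‖ξ‖ ^ m := by have := norm_pos_iff.2 hξ; positivity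
    rw [inv_pow] at h2
    rwa [inv_mul_eq_div, le_div_iff₀ this] at h2
  have key0 : ∀ ξ : EuclideanSpace ℝ (Fin n), 0 ≤ MvPolynomial.eval (fun i => ξ i) P := by
    intro ξ
    by_cases hξ : ξ = 0
    · subst hξ
      have := evalPoly_homog P hP 0 η
      rw [zero_smul] at this
      rw [this]; positivity
    · exact (hell ξ hξ).le
  refine ⟨min 1 a / 2 ^ m, by positivity, fun ξ => ?_⟩
  rw [div_mul_eq_mul_div, mul_div_assoc, ← div_pow]
  by_cases h : ‖ξ‖ ≤ 1
  · have : ((1 + ‖ξ‖) / 2) ^ m ≤ 1 := pow_le_one₀ (by positivity) (by linarith)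
    calc min 1 a * ((1 + ‖ξ‖) / 2) ^ m ≤ 1 * 1 := mul_le_mul (min_le_left _ _) this (by positivity) zero_le_one
      _ ≤ _ := by linarith [key0 ξ]
  · push Not at h
    have h3 := key ξ (by rintro rfl; simp at h; linarith)
    calc _ ≤ a * ‖ξ‖ ^ m := by
          gcongr
          · exact min_le_right _ _
          · linarith
      _ ≤ _ := by linarith

def SymClass {n : ℕ} (P : MvPolynomial (Fin n) ℝ) (m k : ℕ) (h : EuclideanSpace ℝ (Fin n) → ℝ) : Prop :=
  ∃ (Q : MvPolynomial (Fin n) ℝ) (l : ℕ), Q.totalDegree + m * k ≤ m * l ∧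
    ∀ ξ, h ξ = MvPolynomial.eval (fun i => ξ i) Q / (1 + MvPolynomial.eval (fun i => ξ i) P) ^ l

lemma symClass_bound {n m k : ℕ} (hn : 2 ≤ n) (P : MvPolynomial (Fin n) ℝ) (hP : P.IsHomogeneous m)
    (hell : ∀ ξ : EuclideanSpace ℝ (Fin n), ξ ≠ 0 → 0 < MvPolynomial.eval (fun i => ξ i) P)
    (h : EuclideanSpace ℝ (Fin n) → ℝ) (hh : SymClass P m k h) :
    ∃ C : ℝ, 0 ≤ C ∧ ∀ ξ, |h ξ| ≤ C * ((1 + ‖ξ‖) ^ (m * k))⁻¹ := by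
  obtain ⟨Q, l, hd, hQ⟩ := hh
  obtain ⟨C, hC, hb⟩ := evalPoly_bound Q
  obtain ⟨c, hc, hl⟩ := evalPoly_lower hn P hP hell
  refine ⟨C / c ^ l, by positivity, fun ξ => ?_⟩
  have h1 : (1:ℝ) ≤ 1 + ‖ξ‖ := by linarith [norm_nonneg ξ]
  have h0 : (0:ℝ) < 1 + ‖ξ‖ := by linarith
  have hpos : 0 < 1 + MvPolynomial.eval (fun i => ξ i) P := lt_of_lt_of_le (by positivity) (hl ξ)
  rw [hQ, abs_div, abs_pow, abs_of_pos hpos, div_le_iff₀ (by positivity)]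
  calc _ ≤ C * (1 + ‖ξ‖) ^ Q.totalDegree := hb ξ
    _ = C / c ^ l * ((1 + ‖ξ‖) ^ (m * k))⁻¹ * (c ^ l * (1 + ‖ξ‖) ^ (Q.totalDegree + m * k)) := by
        rw [pow_add]; field_simp
    _ ≤ C / c ^ l * ((1 + ‖ξ‖) ^ (m * k))⁻¹ * (c * (1 + ‖ξ‖) ^ m) ^ l := by
        rw [mul_pow, ← pow_mul]
        gcongr
    _ ≤ _ := by
        gcongr
        exact hl ξ

lemma symClass_deriv {n m k : ℕ} (hn : 2 ≤ n) (P : MvPolynomial (Fin n) ℝ) (hP : P.IsHomogeneous m)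
    (hell : ∀ ξ : EuclideanSpace ℝ (Fin n), ξ ≠ 0 → 0 < MvPolynomial.eval (fun i => ξ i) P)
    (h : EuclideanSpace ℝ (Fin n) → ℝ) (hh : SymClass P m k h) (i : Fin n) :
    ∃ h', SymClass P m k h' ∧ ∀ ξ, HasLineDerivAt ℝ h (h' ξ) ξ (EuclideanSpace.single i 1) := by
  obtain ⟨Q, l, hd, hQ⟩ := hh
  obtain ⟨c, hc, hl⟩ := evalPoly_lower hn P hP hell
  have hpos : ∀ ξ : EuclideanSpace ℝ (Fin n), 0 < 1 + MvPolynomial.eval (fun i => ξ i) P :=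
    fun ξ => lt_of_lt_of_le (by positivity) (hl ξ)
  refine ⟨_, ⟨MvPolynomial.pderiv i Q * (1 + P) - MvPolynomial.C (l : ℝ) * Q * MvPolynomial.pderiv i P, l + 1, ?_, fun ξ => rfl⟩, fun ξ => ?_⟩
  · have hP1 := hP.totalDegree_le
    have a1 := totalDegree_pderiv_le' i Q
    have a2 := totalDegree_pderiv_le' i P
    have b1 : (1 + P).totalDegree ≤ m := by
      refine (MvPolynomial.totalDegree_add _ _).trans ?_
      simp [hP1]
    have b2 := MvPolynomial.totalDegree_mul (MvPolynomial.pderiv i Q) (1 + P)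
    have b3 := MvPolynomial.totalDegree_mul (MvPolynomial.C (l : ℝ) * Q) (MvPolynomial.pderiv i P)
    have b4 := MvPolynomial.totalDegree_mul (MvPolynomial.C (l : ℝ)) Q
    rw [MvPolynomial.totalDegree_C] at b4
    have b5 := MvPolynomial.totalDegree_sub (MvPolynomial.pderiv i Q * (1 + P)) (MvPolynomial.C (l : ℝ) * Q * MvPolynomial.pderiv i P)
    have b6 := b5.trans (max_le (c := Q.totalDegree + m) (by omega) (by omega))
    rw [mul_add m l 1, mul_one]
    omega
  · have hq : ∀ R : MvPolynomial (Fin n) ℝ, HasLineDerivAt ℝ (fun η : EuclideanSpace ℝ (Fin n) => MvPolynomial.eval (fun i => η i) R)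
        (MvPolynomial.eval (fun i => ξ i) (MvPolynomial.pderiv i R)) ξ (EuclideanSpace.single i 1) := by
      intro R
      have := (hasFDerivAt_evalPoly R ξ).hasLineDerivAt (EuclideanSpace.single i 1)
      convert! this using 1
      rw [sum_apply, Finset.sum_eq_single i]
      · simp
      · intro b _ hb
        simp [hb]
      · simp
    have e1 := hq Q
    have e2 := hq P
    unfold HasLineDerivAt at e1 e2 ⊢
    have e3 := e1.fun_div ((e2.const_add 1).fun_pow l) (by simpa using pow_ne_zero l (hpos ξ).ne')
    simp only [hQ]
    convert! e3 using 1
    simp only [zero_smul, add_zero, map_sub, map_mul, map_add, map_one, MvPolynomial.eval_C]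
    have := (hpos ξ).ne'
    rcases l with _ | l
    · simp; field_simp
    · simp; field_simp; ring

lemma symClass_integrable {n m k : ℕ} (hn : 2 ≤ n) (P : MvPolynomial (Fin n) ℝ) (hP : P.IsHomogeneous m)
    (hell : ∀ ξ : EuclideanSpace ℝ (Fin n), ξ ≠ 0 → 0 < MvPolynomial.eval (fun i => ξ i) P)
    (hk : n < m * k)
    (h : EuclideanSpace ℝ (Fin n) → ℝ) (hh : SymClass P m k h) : Integrable (fun ξ => (h ξ : ℂ)) := by
  obtain ⟨C, hC, hb⟩ := symClass_bound hn P hP hell h hh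
  have hi : Integrable (fun ξ : EuclideanSpace ℝ (Fin n) => (1 + ‖ξ‖) ^ (-((m * k : ℕ) : ℝ))) :=
    integrable_one_add_norm (by simpa using (by exact_mod_cast hk))
  refine Integrable.mono' (hi.const_mul C) ?_ (.of_forall fun ξ => ?_)
  · obtain ⟨Q, l, hd, hQ⟩ := hh
    have hm : ∀ R : MvPolynomial (Fin n) ℝ, Measurable (fun η : EuclideanSpace ℝ (Fin n) => MvPolynomial.eval (fun i => η i) R) :=
      fun R => (continuous_iff_continuousAt.2 fun ξ => (hasFDerivAt_evalPoly R ξ).continuousAt).measurable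
    have : Measurable h := by
      rw [funext hQ]
      exact (hm Q).div (((hm P).const_add 1).pow_const l)
    exact (Complex.measurable_ofReal.comp this).aestronglyMeasurable
  · rw [Complex.norm_real, Real.norm_eq_abs, Real.rpow_neg (by positivity), Real.rpow_natCast]
    exact hb ξ

def J {n : ℕ} (g : EuclideanSpace ℝ (Fin n) → ℂ) (x : EuclideanSpace ℝ (Fin n)) : ℂ :=
  ∫ ξ, Complex.exp (Complex.I * (⟪x, ξ⟫ : ℂ)) * g ξ

lemma norm_expI {n : ℕ} (x ξ : EuclideanSpace ℝ (Fin n)) : ‖Complex.exp (Complex.I * (⟪x, ξ⟫ : ℂ))‖ = 1 := by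
  rw [mul_comm, Complex.norm_exp_ofReal_mul_I]

lemma integrable_expI {n : ℕ} (x : EuclideanSpace ℝ (Fin n)) (g : EuclideanSpace ℝ (Fin n) → ℂ) (hg : Integrable g) :
    Integrable (fun ξ => Complex.exp (Complex.I * (⟪x, ξ⟫ : ℂ)) * g ξ) := by
  refine hg.bdd_mul (c := 1) (Continuous.aestronglyMeasurable (by fun_prop)) (.of_forall fun ξ => (norm_expI x ξ).le)

lemma J_bound {n : ℕ} (g : EuclideanSpace ℝ (Fin n) → ℂ) : ∀ x, ‖J g x‖ ≤ ∫ ξ, ‖g ξ‖ := by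
  intro x
  refine (norm_integral_le_integral_norm _).trans (le_of_eq ?_)
  simp_rw [norm_mul, norm_expI, one_mul]

lemma J_deriv {n : ℕ} (h h' : EuclideanSpace ℝ (Fin n) → ℝ) (hi : Integrable (fun ξ => (h ξ : ℂ)))
    (hi' : Integrable (fun ξ => (h' ξ : ℂ))) (i : Fin n)
    (hd : ∀ ξ, HasLineDerivAt ℝ h (h' ξ) ξ (EuclideanSpace.single i 1)) (x) :
    ‖J (fun ξ => (h' ξ : ℂ)) x‖ = |x i| * ‖J (fun ξ => (h ξ : ℂ)) x‖ := by
  have key := integral_bilinear_hasLineDerivAt_right_eq_neg_left_of_integrable (μ := volume)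
    (f := fun ξ => Complex.exp (Complex.I * (⟪x, ξ⟫ : ℂ)))
    (f' := fun ξ => Complex.I * x i * Complex.exp (Complex.I * (⟪x, ξ⟫ : ℂ)))
    (g := fun ξ => (h ξ : ℂ)) (g' := fun ξ => (h' ξ : ℂ)) (v := EuclideanSpace.single i (1:ℝ))
    (B := ContinuousLinearMap.mul ℝ ℂ) ?_ ?_ ?_ ?_ ?_
  · simp only [ContinuousLinearMap.mul_apply', mul_assoc] at key
    rw [integral_const_mul, integral_const_mul] at key
    unfold J
    rw [key]
    simp
  · simp only [ContinuousLinearMap.mul_apply', mul_assoc]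
    have := ((integrable_expI x _ hi).const_mul (x i : ℂ)).const_mul Complex.I
    exact this
  · exact integrable_expI x _ hi'
  · exact integrable_expI x _ hi
  · intro ξ _
    unfold HasLineDerivAt
    have h1 : HasDerivAt (fun t : ℝ => ⟪x, ξ + t • EuclideanSpace.single i (1:ℝ)⟫) (x i) 0 := by
      have : (fun t : ℝ => ⟪x, ξ + t • EuclideanSpace.single i (1:ℝ)⟫) = fun t : ℝ => ⟪x, ξ⟫ + t * x i := by
        ext t
        simp [inner_add_right, inner_smul_right, EuclideanSpace.inner_single_right]
      rw [this]
      simpa using ((hasDerivAt_id (0:ℝ)).mul_const (x i)).const_add (⟪x, ξ⟫)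
    have h2 := ((h1.ofReal_comp).const_mul Complex.I).cexp
    convert! h2 using 1
    simp; ring
  · intro ξ _
    exact (hd ξ).ofReal_comp

lemma J_decay_i {n m k : ℕ} (hn : 2 ≤ n) (P : MvPolynomial (Fin n) ℝ) (hP : P.IsHomogeneous m)
    (hell : ∀ ξ : EuclideanSpace ℝ (Fin n), ξ ≠ 0 → 0 < MvPolynomial.eval (fun i => ξ i) P)
    (hk : n < m * k) (i : Fin n) (N : ℕ) :
    ∀ (h : EuclideanSpace ℝ (Fin n) → ℝ) (_ : SymClass P m k h),
      ∃ C : ℝ, ∀ x, |x i| ^ N * ‖J (fun ξ => (h ξ : ℂ)) x‖ ≤ C := by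
  induction N with
  | zero => 
    intro h hh
    exact ⟨_, fun x => by rw [pow_zero, one_mul]; exact J_bound _ x⟩
  | succ N ih =>
    intro h hh
    obtain ⟨h', hh', hd⟩ := symClass_deriv hn P hP hell h hh i
    obtain ⟨C, hC⟩ := ih h' hh'
    refine ⟨C, fun x => ?_⟩
    rw [pow_succ, mul_assoc, ← J_deriv h h' (symClass_integrable hn P hP hell hk h hh)
      (symClass_integrable hn P hP hell hk h' hh') i hd]
    exact hC x

lemma J_decay {n m k : ℕ} (hn : 2 ≤ n) (P : MvPolynomial (Fin n) ℝ) (hP : P.IsHomogeneous m)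
    (hell : ∀ ξ : EuclideanSpace ℝ (Fin n), ξ ≠ 0 → 0 < MvPolynomial.eval (fun i => ξ i) P)
    (hk : n < m * k) (h : EuclideanSpace ℝ (Fin n) → ℝ) (hh : SymClass P m k h) :
    ∃ C : ℝ, ∀ x, ‖J (fun ξ => (h ξ : ℂ)) x‖ ≤ C * (1 + ‖x‖) ^ (-((n + 1 : ℕ) : ℝ)) := by
  choose C hC using fun i => J_decay_i hn P hP hell hk i (n + 1) h hh
  obtain ⟨C0, hC0⟩ : ∃ C0 : ℝ, ∀ x, ‖J (fun ξ => (h ξ : ℂ)) x‖ ≤ C0 := ⟨_, J_bound _⟩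
  have : Nonempty (Fin n) := ⟨⟨0, by omega⟩⟩
  -- (1+|x|)^{n+1} ≤ (1 + ∑|x_i|)^{n+1} ≤ (n+1)^n (1 + ∑ |x_i|^{n+1})
  refine ⟨2 ^ n * (C0 + n ^ n * ∑ i, C i), fun x => ?_⟩
  rw [Real.rpow_neg (by positivity), Real.rpow_natCast, ← div_eq_mul_inv, le_div_iff₀ (by positivity)]
  have h1 : ‖x‖ ≤ ∑ i, |x i| := by
    calc ‖x‖ = ‖∑ i, EuclideanSpace.single i (x i)‖ := by
          congr 1
          ext j
          simp [Finset.sum_apply, Pi.single_apply]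
      _ ≤ ∑ i, ‖EuclideanSpace.single i (x i)‖ := norm_sum_le _ _
      _ = _ := by simp
  have h2 : (∑ i, |x i|) ^ (n + 1) ≤ (n : ℝ) ^ n * ∑ i, |x i| ^ (n + 1) := by
    simpa using pow_sum_le_card_mul_sum_pow (s := Finset.univ) (f := fun i => |x i|) (fun i _ => abs_nonneg (x i)) n
  have h3 : (1 + ‖x‖) ^ (n + 1) ≤ 2 ^ n * (1 ^ (n + 1) + ‖x‖ ^ (n + 1)) := by
    simpa using add_pow_le zero_le_one (norm_nonneg x) (n + 1)
  set Y := ‖J (fun ξ => (h ξ : ℂ)) x‖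
  have hY : 0 ≤ Y := norm_nonneg _
  calc Y * (1 + ‖x‖) ^ (n + 1) ≤ Y * (2 ^ n * (1 ^ (n + 1) + ((n : ℝ) ^ n * ∑ i, |x i| ^ (n + 1)))) := by
        refine mul_le_mul_of_nonneg_left (h3.trans ?_) hY
        gcongr
        refine le_trans ?_ h2
        gcongr
    _ = 2 ^ n * (Y + (n : ℝ) ^ n * ∑ i, |x i| ^ (n + 1) * Y) := by
        rw [← Finset.sum_mul]; simp; ring
    _ ≤ _ := by
        gcongr with i
        · exact hC0 x
        · exact hC i x

lemma young_aux {n : ℕ} (κ : EuclideanSpace ℝ (Fin n) → ℝ≥0∞) (hκ : Measurable κ) (A B : ℝ≥0∞)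
    (hA : ∫⁻ x, κ x ≤ A) (hB : ∀ x, κ x ≤ B) (p q : ℝ≥0∞) (hp : 1 ≤ p) (hpq : p ≤ q)
    (f u : EuclideanSpace ℝ (Fin n) → ℂ) (hf : Measurable f)
    (hu : ∀ x, ‖u x‖ₑ ≤ ∫⁻ y, κ (x - y) * ‖f y‖ₑ) :
    eLpNorm u q volume ≤ A ^ (1 - ((1/p).toReal - (1/q).toReal)) * B ^ ((1/p).toReal - (1/q).toReal) *
      eLpNorm f p volume := by
  have hκx : ∀ x, Measurable (fun y => κ (x - y)) := fun x => hκ.comp (measurable_const.sub measurable_id)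
  have hmass : ∀ x, (volume.withDensity (fun y => κ (x - y))) Set.univ ≤ A := by
    intro x
    rw [withDensity_apply _ MeasurableSet.univ, Measure.restrict_univ, lintegral_sub_left_eq_self]
    exact hA
  have h1p : 0 ≤ 1 - 1 / p.toReal := by
    by_cases h : p = ∞
    · simp [h]
    · have : 1 ≤ p.toReal := by
        simpa using (ENNReal.toReal_le_toReal ENNReal.one_ne_top h).2 hp
      rw [sub_nonneg, div_le_one (by linarith)]; exact this
  have hpt : ∀ x, ‖u x‖ₑ ≤ eLpNorm f p (volume.withDensity (fun y => κ (x - y))) * A ^ (1 - 1 / p.toReal) := by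
    intro x
    refine (hu x).trans ?_
    have h1 := eLpNorm_le_eLpNorm_mul_rpow_measure_univ (μ := volume.withDensity (fun y => κ (x - y))) hp
      hf.aestronglyMeasurable
    rw [eLpNorm_one_eq_lintegral_enorm, lintegral_withDensity_eq_lintegral_mul _ (hκx x) hf.enorm] at h1
    refine h1.trans ?_
    simp only [ENNReal.toReal_one, div_one]
    gcongr
    exact hmass x
  by_cases hpt' : p = ∞
  · have hq : q = ∞ := by rw [hpt'] at hpq; exact top_le_iff.1 hpq
    subst hpt' hq
    simp only [sub_self, sub_zero, ENNReal.rpow_one, ENNReal.rpow_zero, mul_one]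
    refine eLpNormEssSup_le_of_ae_enorm_bound (.of_forall fun x => (hpt x).trans ?_)
    rw [mul_comm]
    simp only [ENNReal.toReal_top, div_zero, sub_zero, ENNReal.rpow_one]
    exact mul_le_mul_right (eLpNormEssSup_mono_measure f (withDensity_absolutelyContinuous _ _)) _
  have hp0 : p ≠ 0 := (lt_of_lt_of_le one_pos hp).ne'
  set r := p.toReal with hr
  have hr1 : 1 ≤ r := by
    simpa using (ENNReal.toReal_le_toReal ENNReal.one_ne_top hpt').2 hp
  have hr0 : 0 < r := by linarith
  set V : EuclideanSpace ℝ (Fin n) → ℝ≥0∞ := fun x => ∫⁻ y, κ (x - y) * ‖f y‖ₑ ^ r with hV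
  have hjm : Measurable (Function.uncurry fun x y : EuclideanSpace ℝ (Fin n) => κ (x - y) * ‖f y‖ₑ ^ r) :=
    (hκ.comp (measurable_fst.sub measurable_snd)).mul ((hf.enorm.pow_const r).comp measurable_snd)
  have hVm : Measurable V := hjm.lintegral_prod_right'
  set N := eLpNorm f p volume with hN
  have hNr : ∫⁻ y, ‖f y‖ₑ ^ r = N ^ r := by
    rw [hN, eLpNorm_eq_lintegral_rpow_enorm_toReal hp0 hpt', ← ENNReal.rpow_mul, one_div,
      inv_mul_cancel₀ hr0.ne', ENNReal.rpow_one]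
  have hVB : ∀ x, V x ≤ B * N ^ r := by
    intro x
    rw [← hNr, ← lintegral_const_mul _ (hf.enorm.pow_const r)]
    exact lintegral_mono fun y => by gcongr; exact hB _
  have hVI : ∫⁻ x, V x ≤ A * N ^ r := by
    rw [hV, lintegral_lintegral_swap hjm.aemeasurable, ← hNr, ← lintegral_const_mul _ (hf.enorm.pow_const r)]
    refine lintegral_mono fun y => ?_
    rw [lintegral_mul_const _ (show Measurable (fun x => κ (x - y)) from hκ.comp (measurable_id.sub measurable_const)), lintegral_sub_right_eq_self κ y]
    gcongr
  have hpt2 : ∀ x, ‖u x‖ₑ ≤ V x ^ (1 / r) * A ^ (1 - 1 / r) := by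
    intro x
    refine (hpt x).trans (le_of_eq ?_)
    rw [eLpNorm_eq_lintegral_rpow_enorm_toReal hp0 hpt', lintegral_withDensity_eq_lintegral_mul _ (hκx x) (hf.enorm.pow_const _)]
    rfl
  have e1 : (1 / p).toReal = 1 / r := by simp [hr]
  rw [e1]
  by_cases hq : q = ∞
  · subst hq
    simp only [ENNReal.div_top, ENNReal.toReal_zero, sub_zero]
    refine eLpNormEssSup_le_of_ae_enorm_bound (.of_forall fun x => (hpt2 x).trans ?_)
    calc V x ^ (1 / r) * A ^ (1 - 1 / r) ≤ (B * N ^ r) ^ (1 / r) * A ^ (1 - 1 / r) := by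
          gcongr; exact hVB x
      _ = _ := by
          rw [ENNReal.mul_rpow_of_nonneg _ _ (by positivity), ← ENNReal.rpow_mul, mul_one_div_cancel hr0.ne', ENNReal.rpow_one]
          ring
  have hq0 : q ≠ 0 := (lt_of_lt_of_le one_pos (hp.trans hpq)).ne'
  set s := q.toReal with hs
  have hrs : r ≤ s := (ENNReal.toReal_le_toReal hpt' hq).2 hpq
  have hs0 : 0 < s := by linarith
  have e2 : (1 / q).toReal = 1 / s := by simp [hs]
  rw [e2, eLpNorm_eq_lintegral_rpow_enorm_toReal hq0 hq, ← hs]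
  have hsr : 0 ≤ s / r - 1 := by rw [sub_nonneg, one_le_div hr0]; exact hrs
  have hsr' : 0 ≤ s - s / r := by rw [sub_nonneg, div_le_iff₀ hr0]; nlinarith
  have hpt3 : ∀ x, ‖u x‖ₑ ^ s ≤ (B * N ^ r) ^ (s / r - 1) * A ^ (s - s / r) * V x := by
    intro x
    calc ‖u x‖ₑ ^ s ≤ (V x ^ (1 / r) * A ^ (1 - 1 / r)) ^ s := by gcongr; exact hpt2 x
      _ = V x ^ ((s / r - 1) + 1) * A ^ (s - s / r) := by
          rw [ENNReal.mul_rpow_of_nonneg _ _ hs0.le, ← ENNReal.rpow_mul, ← ENNReal.rpow_mul]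
          congr 2 <;> ring
      _ = V x ^ (s / r - 1) * A ^ (s - s / r) * V x := by
          rw [ENNReal.rpow_add_of_nonneg _ _ hsr zero_le_one, ENNReal.rpow_one]; ring
      _ ≤ _ := by gcongr; exact hVB x
  calc (∫⁻ x, ‖u x‖ₑ ^ s) ^ (1 / s) 
      ≤ ((B * N ^ r) ^ (s / r - 1) * A ^ (s - s / r) * (A * N ^ r)) ^ (1 / s) := by
        gcongr
        refine (lintegral_mono hpt3).trans ?_
        rw [lintegral_const_mul _ hVm]
        gcongr
    _ = (B ^ (s / r - 1) * A ^ (s - s / r + 1) * N ^ s) ^ (1 / s) := by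
        congr 1
        have : N ^ s = N ^ (r * (s / r - 1)) * N ^ r := by
          rw [← ENNReal.rpow_add_of_nonneg _ _ (by positivity) hr0.le]
          congr 1; field_simp; ring
        rw [this, ENNReal.mul_rpow_of_nonneg _ _ hsr, ← ENNReal.rpow_mul,
          ENNReal.rpow_add_of_nonneg _ _ hsr' zero_le_one, ENNReal.rpow_one]
        ring
    _ = _ := by
        have hs1 : 0 ≤ 1 / s := by positivity
        rw [ENNReal.mul_rpow_of_nonneg _ _ hs1, ENNReal.mul_rpow_of_nonneg _ _ hs1, ← ENNReal.rpow_mul,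
          ← ENNReal.rpow_mul, ← ENNReal.rpow_mul, mul_one_div_cancel hs0.ne', ENNReal.rpow_one,
          mul_comm (B ^ _)]
        congr 3 <;> field_simp
        ring

lemma J_continuous {n : ℕ} (g : EuclideanSpace ℝ (Fin n) → ℂ) (hg : Integrable g) : Continuous (J g) := by
  refine continuous_of_dominated (bound := fun ξ => ‖g ξ‖) (fun x => (integrable_expI x g hg).aestronglyMeasurable)
    (fun x => .of_forall fun ξ => ?_) hg.norm (.of_forall fun ξ => by fun_prop)
  rw [norm_mul, norm_expI, one_mul]

lemma J_scale {n : ℕ} (g : EuclideanSpace ℝ (Fin n) → ℂ) (s : ℝ) (hs : 0 < s) (x) :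
    J (fun ξ => g (s • ξ)) x = ((s ^ n)⁻¹ : ℝ) • J g (s⁻¹ • x) := by
  have := Measure.integral_comp_smul volume
    (fun η : EuclideanSpace ℝ (Fin n) => Complex.exp (Complex.I * (⟪s⁻¹ • x, η⟫ : ℂ)) * g η) s
  rw [abs_of_nonneg (by positivity)] at this
  simp only [finrank_euclideanSpace, Fintype.card_fin] at this
  unfold J
  rw [← this]
  congr 1
  ext ξ
  rw [real_inner_smul_left, real_inner_smul_right, inv_mul_cancel_left₀ hs.ne']

lemma IFT_FT {n : ℕ} (g f : EuclideanSpace ℝ (Fin n) → ℂ) (hg : Integrable g) (hf : Integrable f) (x) :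
    IFT (fun ξ => g ξ * FT f ξ) x = ∫ y, (((2 * Real.pi) ^ n : ℝ) : ℂ)⁻¹ * J g (x - y) * f y := by
  unfold IFT FT J
  simp_rw [mul_assoc]
  rw [integral_const_mul]
  congr 1
  simp_rw [← integral_const_mul, ← integral_mul_const]
  rw [integral_integral_swap]
  · refine integral_congr_ae (.of_forall fun y => integral_congr_ae (.of_forall fun ξ => ?_))
    have : Complex.exp (Complex.I * (⟪x - y, ξ⟫ : ℂ)) =
      Complex.exp (Complex.I * (⟪x, ξ⟫ : ℂ)) * Complex.exp (-Complex.I * (⟪y, ξ⟫ : ℂ)) := by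
      rw [← Complex.exp_add, inner_sub_left]; congr 1; push_cast; ring
    simp only [this]; ring
  · have h := hg.mul_prod hf
    have h2 := h.bdd_mul (c := 1) (f := fun z : EuclideanSpace ℝ (Fin n) × EuclideanSpace ℝ (Fin n) =>
      Complex.exp (Complex.I * (⟪x, z.1⟫ : ℂ)) * Complex.exp (Complex.I * (⟪-z.2, z.1⟫ : ℂ)))
      (Continuous.aestronglyMeasurable (by fun_prop))
      (.of_forall fun z => by rw [norm_mul, norm_expI, norm_expI, one_mul])
    convert! h2 using 1
    ext z
    simp only [Function.uncurry, inner_neg_left]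
    push_cast
    ring_nf

/-- `L^p → L^q` bounds for powers of the resolvent `(I + tP(D))^{−k}` when `k > n/m`,
for all `1 ≤ p ≤ q ≤ ∞`. -/
theorem statement14
    (n m : ℕ) (hn : 2 ≤ n) (hm : 2 ≤ m) (hnm : m < n)
    (P : MvPolynomial (Fin n) ℝ) (hhom : P.IsHomogeneous m)
    (Pf : EuclideanSpace ℝ (Fin n) → ℝ)
    (hPf : ∀ ξ, Pf ξ = MvPolynomial.eval (fun i => ξ i) P)
    (hell : ∀ ξ : EuclideanSpace ℝ (Fin n), ξ ≠ 0 → 0 < Pf ξ)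
    (hnd : ∀ ξ : EuclideanSpace ℝ (Fin n), ξ ≠ 0 → HessDet Pf ξ ≠ 0)
    (k : ℕ) (hk : (n : ℝ) / (m : ℝ) < (k : ℝ))
    (p q : ℝ≥0∞) (hp : 1 ≤ p) (hpq : p ≤ q) :
    ∃ C : ℝ, 0 < C ∧ ∀ t : ℝ, 0 < t →
      ∀ f : SchwartzMap (EuclideanSpace ℝ (Fin n)) ℂ,
        eLpNorm (IFT (fun ξ => (((1 + t * Pf ξ) ^ k : ℝ) : ℂ)⁻¹ * FT (⇑f) ξ)) q volume ≤
          ENNReal.ofReal (C * t ^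
            (-((n : ℝ)/(m : ℝ)) * ((1/p).toReal - (1/q).toReal))) *
          eLpNorm (⇑f) p volume := by
  obtain rfl : Pf = fun ξ => MvPolynomial.eval (fun i => ξ i) P := funext hPf
  have hm0 : (0:ℝ) < m := by exact_mod_cast (by omega : 0 < m)
  have hmk : n < m * k := by
    rw [div_lt_iff₀ hm0] at hk
    have : (n:ℝ) < ((m * k : ℕ) : ℝ) := by push_cast; linarith
    exact_mod_cast this
  set h : EuclideanSpace ℝ (Fin n) → ℝ := fun ξ => ((1 + MvPolynomial.eval (fun i => ξ i) P) ^ k)⁻¹ with hh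
  have hS : SymClass P m k h := ⟨1, k, by simp, fun ξ => by simp [hh]⟩
  obtain ⟨C0, hC0⟩ := J_decay hn P hhom hell hmk h hS
  have hint := symClass_integrable hn P hhom hell hmk h hS
  set G : EuclideanSpace ℝ (Fin n) → ℂ := fun ξ => (h ξ : ℂ) with hG
  have hJc := J_continuous G hint
  have hJi : Integrable (J G) := by
    refine Integrable.mono' ((integrable_one_add_norm (r := ((n + 1 : ℕ) : ℝ)) (by simp)).const_mul C0)
      hJc.aestronglyMeasurable (.of_forall hC0)
  set c : ℝ := ((2 * Real.pi) ^ n)⁻¹ with hc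
  have hc0 : 0 < c := by positivity
  set a : ℝ := c * (∫ x, ‖J G x‖) + 1 with ha
  set b : ℝ := c * (∫ ξ, ‖G ξ‖) + 1 with hb
  have ha0 : 0 < a := by positivity
  have hb0 : 0 < b := by positivity
  set e : ℝ := (1/p).toReal - (1/q).toReal with he
  refine ⟨a ^ (1 - e) * b ^ e, by positivity, fun t ht f => ?_⟩
  set s : ℝ := t ^ (1 / (m:ℝ)) with hs
  have hs0 : 0 < s := by positivity
  have hsm : s ^ m = t := by
    rw [hs, ← Real.rpow_natCast, ← Real.rpow_mul ht.le, one_div_mul_cancel hm0.ne', Real.rpow_one]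
  have hsn : (s ^ n)⁻¹ = t ^ (-((n:ℝ)/m)) := by
    rw [hs, ← Real.rpow_natCast, ← Real.rpow_mul ht.le, ← Real.rpow_neg ht.le]
    congr 1; ring
  have hgt : (fun ξ : EuclideanSpace ℝ (Fin n) => (((1 + t * MvPolynomial.eval (fun i => ξ i) P) ^ k : ℝ) : ℂ)⁻¹) = fun ξ => G (s • ξ) := by
    ext ξ
    simp only [hG, hh]
    rw [evalPoly_homog P hhom, hsm]
    push_cast
    rfl
  have hgti : Integrable (fun ξ => G (s • ξ)) := hint.comp_smul hs0.ne'
  set κ : EuclideanSpace ℝ (Fin n) → ℝ≥0∞ := fun x => ENNReal.ofReal (c * (s ^ n)⁻¹ * ‖J G (s⁻¹ • x)‖) with hκ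
  have hκm : Measurable κ := by
    have : Continuous (fun x => c * (s ^ n)⁻¹ * ‖J G (s⁻¹ • x)‖) := by fun_prop
    exact this.measurable.ennreal_ofReal
  have hJi2 : Integrable (fun x => c * (s ^ n)⁻¹ * ‖J G (s⁻¹ • x)‖) :=
    ((hJi.norm.comp_smul (inv_ne_zero hs0.ne'))).const_mul _
  have hA : ∫⁻ x, κ x ≤ ENNReal.ofReal a := by
    rw [hκ, ← ofReal_integral_eq_lintegral_ofReal hJi2 (.of_forall fun x => by positivity)]
    apply ENNReal.ofReal_le_ofReal
    rw [integral_const_mul, Measure.integral_comp_smul volume (fun x => ‖J G x‖) s⁻¹]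
    simp only [finrank_euclideanSpace, Fintype.card_fin, smul_eq_mul, inv_pow, inv_inv]
    rw [abs_of_pos (by positivity), mul_assoc, inv_mul_cancel_left₀ (by positivity)]
    linarith
  have hB : ∀ x, κ x ≤ ENNReal.ofReal (b * (s ^ n)⁻¹) := by
    intro x
    apply ENNReal.ofReal_le_ofReal
    have := J_bound G (s⁻¹ • x)
    calc c * (s ^ n)⁻¹ * ‖J G (s⁻¹ • x)‖ = (c * ‖J G (s⁻¹ • x)‖) * (s ^ n)⁻¹ := by ring
      _ ≤ (c * ∫ ξ, ‖G ξ‖) * (s ^ n)⁻¹ := by gcongr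
      _ ≤ _ := by gcongr; linarith
  have hY := young_aux κ hκm _ _ hA hB p q hp hpq f
    (IFT (fun ξ => (((1 + t * MvPolynomial.eval (fun i => ξ i) P) ^ k : ℝ) : ℂ)⁻¹ * FT (⇑f) ξ))
    f.continuous.measurable ?_
  · refine hY.trans (le_of_eq ?_)
    congr 1
    rw [← he, ENNReal.ofReal_rpow_of_pos ha0, ENNReal.ofReal_rpow_of_pos (by positivity),
      ← ENNReal.ofReal_mul (by positivity), Real.mul_rpow hb0.le (by positivity), hsn, ← Real.rpow_mul ht.le,
      mul_assoc]
  · intro x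
    have h1 := IFT_FT (fun ξ => G (s • ξ)) f hgti f.integrable x
    have h2 : (fun ξ : EuclideanSpace ℝ (Fin n) => (((1 + t * MvPolynomial.eval (fun i => ξ i) P) ^ k : ℝ) : ℂ)⁻¹ * FT (⇑f) ξ)
        = fun ξ => G (s • ξ) * FT f ξ := by
      ext ξ
      rw [← congrFun hgt ξ]
    rw [h2, h1]
    refine (enorm_integral_le_lintegral_enorm _).trans (le_of_eq ?_)
    congr 1
    ext y
    rw [enorm_mul]
    congr 1
    rw [J_scale G s hs0, ← ofReal_norm_eq_enorm, hκ]
    simp only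
    congr 1
    rw [norm_mul, norm_smul, norm_inv, Complex.norm_real, Real.norm_of_nonneg (by positivity), Real.norm_of_nonneg (by positivity)]
    ring
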